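/- Let R > 0 and define the low-temperature non-equilibrium Landau potential G : ℝ → ℝ by G(Φ) = −log k_R(Φ/√2). Then G is smooth in a neighborhood of 0 and its derivatives at 0 are: G'(0) = c₁ where c₁ = √2·Γ(1+R/2)/Γ((1+R)/2); G''(0) = c₁² − (1+R) (equal to twice the coefficient a₂ = c₁²/2 − (1+R)/2); and G'''(0) = 2c₁·(c₁² − 1/2 − R) (equal to six times the coefficient c₃ = (c₁/3)·(c₁² − 1/2 − R)). -/

import Mathlib

open Real MeasureTheory Filter Topology

/-- `kFun R x = ∫₀^∞ t^R exp(-t² - 2xt) dt`, i.e. `Γ(1+R) · H(-1-R, x)`. -/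
noncomputable def kFun (R x : ℝ) : ℝ :=
  ∫ t in Set.Ioi (0 : ℝ), t ^ R * Real.exp (-t ^ 2 - 2 * x * t)

/-- The low-temperature non-equilibrium Landau potential `G(Φ) = -log k_R(Φ/√2)`. -/
noncomputable def Gpot (R : ℝ) : ℝ → ℝ :=
  fun Φ => -Real.log (kFun R (Φ / Real.sqrt 2))

/-- The linear coefficient `c₁ = √2·Γ(1+R/2)/Γ((1+R)/2)`. -/
noncomputable def c₁ (R : ℝ) : ℝ :=
  Real.sqrt 2 * Real.Gamma (1 + R / 2) / Real.Gamma ((1 + R) / 2)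

lemma continuousOn_rpow_mul_exp (R x : ℝ) :
    ContinuousOn (fun t : ℝ => t ^ R * Real.exp (-t ^ 2 - 2 * x * t)) (Set.Ioi 0) :=
  (continuousOn_id.rpow_const fun _ ht => Or.inl (ne_of_gt ht)).mul
    (by fun_prop : Continuous fun t : ℝ => Real.exp (-t ^ 2 - 2 * x * t)).continuousOn

lemma integrableOn_rpow_mul_exp {R : ℝ} (hR : -1 < R) (x : ℝ) :
    IntegrableOn (fun t : ℝ => t ^ R * Real.exp (-t ^ 2 - 2 * x * t)) (Set.Ioi 0) := by
  have h := (integrableOn_rpow_mul_exp_neg_mul_sq (b := 1 / 2) (by norm_num) hR).const_mul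
    (Real.exp (2 * x ^ 2))
  refine Integrable.mono' h
    ((continuousOn_rpow_mul_exp R x).aestronglyMeasurable measurableSet_Ioi) ?_
  refine (ae_restrict_iff' measurableSet_Ioi).2 (Eventually.of_forall fun t ht => ?_)
  have ht : 0 < t := ht
  rw [Real.norm_of_nonneg (by positivity), mul_left_comm, ← Real.exp_add]
  gcongr
  nlinarith [sq_nonneg (t + 2 * x)]

lemma kFun_pos {R : ℝ} (hR : -1 < R) (x : ℝ) : 0 < kFun R x := by
  have hpos : ∀ t ∈ Set.Ioi (0 : ℝ), 0 < t ^ R * Real.exp (-t ^ 2 - 2 * x * t) := fun t ht =>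
    mul_pos (Real.rpow_pos_of_pos ht R) (Real.exp_pos _)
  refine (setIntegral_pos_iff_support_of_nonneg_ae
    ((ae_restrict_iff' measurableSet_Ioi).2 (Eventually.of_forall fun t ht => (hpos t ht).le))
    (integrableOn_rpow_mul_exp hR x)).2 ?_
  rw [Set.inter_eq_right.2 fun t ht => Function.mem_support.2 (hpos t ht).ne', Real.volume_Ioi]
  exact ENNReal.zero_lt_top

lemma hasDerivAt_kFun {R : ℝ} (hR : -1 < R) (x : ℝ) :
    HasDerivAt (kFun R) (-2 * kFun (R + 1) x) x := by
  have key := hasDerivAt_integral_of_dominated_loc_of_deriv_le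
    (μ := volume.restrict (Set.Ioi (0 : ℝ)))
    (F := fun x t : ℝ => t ^ R * Real.exp (-t ^ 2 - 2 * x * t))
    (F' := fun x t : ℝ => -2 * (t ^ (R + 1) * Real.exp (-t ^ 2 - 2 * x * t)))
    (bound := fun t : ℝ => 2 * (t ^ (R + 1) * Real.exp (-t ^ 2 - 2 * (x - 1) * t)))
    (x₀ := x) (Ioi_mem_nhds (sub_one_lt x))
    (Eventually.of_forall fun y =>
      (continuousOn_rpow_mul_exp R y).aestronglyMeasurable measurableSet_Ioi)
    (integrableOn_rpow_mul_exp hR x)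
    (((continuousOn_rpow_mul_exp (R + 1) x).const_smul (-2 : ℝ)).aestronglyMeasurable
      measurableSet_Ioi)
    ((ae_restrict_iff' measurableSet_Ioi).2 (Eventually.of_forall fun t ht y hy => by
      have ht : 0 < t := ht
      have hy : x - 1 < y := hy
      rw [norm_mul, Real.norm_of_nonneg (by positivity : 0 ≤ t ^ (R + 1) * _), norm_neg,
        Real.norm_ofNat]
      gcongr))
    ((integrableOn_rpow_mul_exp (by linarith) (x - 1)).const_mul 2)
    ((ae_restrict_iff' measurableSet_Ioi).2 (Eventually.of_forall fun t ht y _ => by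
      have ht : 0 < t := ht
      have h : HasDerivAt (fun y : ℝ => -t ^ 2 - 2 * y * t) (-(2 * 1 * t)) y :=
        (((hasDerivAt_id y).const_mul 2).mul_const t).const_sub _
      refine (h.exp.const_mul (t ^ R)).congr_deriv ?_
      rw [Real.rpow_add_one ht.ne']
      ring))
  have h := key.2
  rwa [integral_const_mul] at h

lemma contDiff_kFun {R : ℝ} (hR : -1 < R) : ContDiff ℝ (⊤ : ℕ∞) (kFun R) := by
  refine contDiff_infty.2 fun n => ?_
  induction n generalizing R with
  | zero =>
    exact contDiff_zero.2 (continuous_iff_continuousAt.2 fun x =>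
      (hasDerivAt_kFun hR x).continuousAt)
  | succ n ih =>
    push_cast
    refine contDiff_succ_iff_deriv.2
      ⟨fun x => (hasDerivAt_kFun hR x).differentiableAt, by simp, ?_⟩
    rw [funext fun x => (hasDerivAt_kFun hR x).deriv]
    exact contDiff_const.mul (ih (by linarith))

lemma kFun_zero {R : ℝ} (hR : -1 < R) : kFun R 0 = 1 / 2 * Real.Gamma ((R + 1) / 2) := by
  rw [← integral_rpow_mul_exp_neg_rpow two_pos hR]
  simp [kFun]

lemma kFun_add_two_zero {R : ℝ} (hR : -1 < R) : kFun (R + 2) 0 = (R + 1) / 2 * kFun R 0 := by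
  rw [kFun_zero hR, kFun_zero (by linarith), show (R + 2 + 1) / 2 = (R + 1) / 2 + 1 by ring,
    Real.Gamma_add_one (by linarith)]
  ring

lemma hasDerivAt_kFun_div_sqrt_two {R : ℝ} (hR : -1 < R) (x : ℝ) :
    HasDerivAt (fun y => kFun R (y / √2)) (-√2 * kFun (R + 1) (x / √2)) x := by
  refine ((hasDerivAt_kFun hR (x / √2)).comp x ((hasDerivAt_id x).div_const √2)).congr_deriv ?_
  rw [mul_one_div, mul_div_right_comm, neg_div, Real.div_sqrt]

lemma contDiff_Gpot {R : ℝ} (hR : -1 < R) : ContDiff ℝ (⊤ : ℕ∞) (Gpot R) :=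
  (((contDiff_kFun hR).comp (contDiff_id.div_const √2)).log fun _ => (kFun_pos hR _).ne').neg

lemma deriv_Gpot {R : ℝ} (hR : -1 < R) :
    deriv (Gpot R) = fun x => √2 * (kFun (R + 1) (x / √2) / kFun R (x / √2)) := by
  funext x
  refine (((hasDerivAt_kFun_div_sqrt_two hR x).log (kFun_pos hR _).ne').neg).deriv.trans ?_
  ring

lemma hasDerivAt_kFun_ratio {R : ℝ} (hR : -1 < R) (x : ℝ) :
    HasDerivAt (fun y => kFun (R + 1) (y / √2) / kFun R (y / √2))
      (√2 * ((kFun (R + 1) (x / √2) / kFun R (x / √2)) ^ 2 -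
        kFun (R + 2) (x / √2) / kFun R (x / √2))) x := by
  have h0 := (kFun_pos hR (x / √2)).ne'
  refine ((hasDerivAt_kFun_div_sqrt_two (by linarith : -1 < R + 1) x).div
    (hasDerivAt_kFun_div_sqrt_two hR x) h0).congr_deriv ?_
  rw [show R + 1 + 1 = R + 2 by ring]
  field_simp
  ring

lemma deriv_deriv_Gpot {R : ℝ} (hR : -1 < R) :
    deriv (deriv (Gpot R)) = fun x => 2 * ((kFun (R + 1) (x / √2) / kFun R (x / √2)) ^ 2 -
      kFun (R + 2) (x / √2) / kFun R (x / √2)) := by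
  funext x
  rw [deriv_Gpot hR, ((hasDerivAt_kFun_ratio hR x).const_mul √2).deriv, ← mul_assoc,
    Real.mul_self_sqrt zero_le_two]

lemma deriv_deriv_deriv_Gpot {R : ℝ} (hR : -1 < R) (x : ℝ) :
    deriv (deriv (deriv (Gpot R))) x =
      2 * √2 * (2 * (kFun (R + 1) (x / √2) / kFun R (x / √2)) ^ 3 -
        3 * (kFun (R + 1) (x / √2) / kFun R (x / √2)) * (kFun (R + 2) (x / √2) / kFun R (x / √2)) +
        kFun (R + 3) (x / √2) / kFun R (x / √2)) := by
  have h0 := (kFun_pos hR (x / √2)).ne'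
  have h2 := (hasDerivAt_kFun_div_sqrt_two (by linarith : -1 < R + 2) x).div
    (hasDerivAt_kFun_div_sqrt_two hR x) h0
  rw [deriv_deriv_Gpot hR]
  refine ((((hasDerivAt_kFun_ratio hR x).pow 2).sub h2).const_mul 2).deriv.trans ?_
  rw [show R + 2 + 1 = R + 3 by ring, show 2 - 1 = 1 from rfl, pow_one]
  generalize x / √2 = y at h0 ⊢
  field_simp
  ring

lemma c₁_eq_kFun_ratio {R : ℝ} (hR : -1 < R) : c₁ R = √2 * (kFun (R + 1) 0 / kFun R 0) := by
  rw [kFun_zero hR, kFun_zero (by linarith), c₁, mul_div_mul_left _ _ (by norm_num), mul_div_assoc,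
    show (R + 1 + 1) / 2 = 1 + R / 2 by ring, add_comm 1 R]

/-- For `R > 0`, the potential `G(Φ) = -log k_R(Φ/√2)` is smooth near `0` with
`G'(0) = c₁`, `G''(0) = c₁² - (1+R) (= 2a₂)` and `G'''(0) = 2c₁(c₁² - 1/2 - R) (= 6c₃)`. -/
theorem low_temperature_expansion (R : ℝ) (hR : 0 < R) :
    (∃ U ∈ 𝓝 (0 : ℝ), ContDiffOn ℝ (⊤ : ℕ∞) (Gpot R) U) ∧
    deriv (Gpot R) 0 = c₁ R ∧
    iteratedDeriv 2 (Gpot R) 0 = c₁ R ^ 2 - (1 + R) ∧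
    iteratedDeriv 3 (Gpot R) 0 = 2 * c₁ R * (c₁ R ^ 2 - 1 / 2 - R) := by
  have hR' : -1 < R := by linarith
  have hs : √2 ^ 2 = (2 : ℝ) := Real.sq_sqrt zero_le_two
  have h0 := (kFun_pos hR' 0).ne'
  have h2 : kFun (R + 2) 0 / kFun R 0 = (R + 1) / 2 := by
    rw [kFun_add_two_zero hR', mul_div_cancel_right₀ _ h0]
  have h3 : kFun (R + 3) 0 / kFun R 0 = (R + 2) / 2 * (kFun (R + 1) 0 / kFun R 0) := by
    rw [show R + 3 = R + 1 + 2 by ring, kFun_add_two_zero (by linarith)]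
    ring
  refine ⟨⟨Set.univ, univ_mem, (contDiff_Gpot hR').contDiffOn⟩, ?_, ?_, ?_⟩
  · simp only [deriv_Gpot hR', c₁_eq_kFun_ratio hR', zero_div]
  · rw [iteratedDeriv_succ, iteratedDeriv_one, deriv_deriv_Gpot hR', c₁_eq_kFun_ratio hR']
    simp only [zero_div, h2]
    rw [mul_pow, hs]
    ring
  · rw [iteratedDeriv_succ, iteratedDeriv_succ, iteratedDeriv_one, deriv_deriv_deriv_Gpot hR',
      c₁_eq_kFun_ratio hR']
    simp only [zero_div, h2, h3]
    rw [mul_pow, hs]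
    ring
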